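/- arXiv:2403.13539 — 2 statements merged into one kernel-verified Lean document; each statement's English description precedes it below -/
import Mathlib

section
/- Variable exponent under a non-logarithmic condition: let s ∈ (0,∞), s⋆ = s/(n+s), L > 0, let μ̄ : (0,1) → [1,∞) be non-increasing with f(r) := log(μ̄(r))/log(1/r) non-decreasing, and let p : Ω → (1,∞) satisfy osc_{B_r(x₀)} p ≤ L · log(μ̄(r))/log(1/r) for every ball B_r(x₀) ⊂ Ω with 0 < r < 1. Then for every ball B_r(x₀) ⊂ Ω with 0 < r < 1 and every k such that r < k and r ≤ (r/k)^{s⋆} < 1, the function Φ₃(x,v) = v^{p(x)} satisfies sup_{x∈B_r(x₀)} (k/r)^{p(x)} ≤ [μ̄((r/k)^{s⋆})]^{L/s⋆} · inf_{x∈B_r(x₀)} (k/r)^{p(x)}; that is, Φ₃ satisfies the non-logarithmic condition (Φ_{λ,μ}) with λ ≡ 1 and μ(ρ) = [μ̄(ρ)]^{L/s⋆}. -/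
open MeasureTheory Metric Set Real

noncomputable section

/-- ℝⁿ as Euclidean space. -/
abbrev En (n : ℕ) := EuclideanSpace ℝ (Fin n)

/-- **Variable exponent under a non-logarithmic condition.**  Let `s ∈ (0,∞)`,
`s⋆ = s/(n+s)`, `L > 0`, let `μ̄ : (0,1) → [1,∞)` be non-increasing with
`f(r) = log(μ̄(r))/log(1/r)` non-decreasing, and let `p(·)` satisfy
`osc_{B_r(x₀)} p ≤ L log(μ̄(r))/log(1/r)` on all balls `B_r(x₀) ⊆ Ω`, `0 < r < 1`.
Then for every ball `B_r(x₀) ⊆ Ω` with `0 < r < 1` and every `k` with `r < k` and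
`r ≤ (r/k)^{s⋆} < 1`, the function `Φ₃(x,v) = v^{p(x)}` satisfies
`sup_{B_r(x₀)} (k/r)^{p(x)} ≤ μ̄((r/k)^{s⋆})^{L/s⋆} inf_{B_r(x₀)} (k/r)^{p(x)}`;
i.e. `Φ₃` satisfies `(Φ_{λ,μ})` with `λ ≡ 1`, `μ(ρ) = μ̄(ρ)^{L/s⋆}`. -/
theorem variable_exponent_condition
    (n : ℕ) (Ω : Set (En n)) (s L : ℝ) (μbar : ℝ → ℝ) (pfun : En n → ℝ)
    (hn : 0 < n) (hΩo : IsOpen Ω) (hΩb : Bornology.IsBounded Ω)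
    (hs : 0 < s) (hL : 0 < L)
    (hμ1 : ∀ r : ℝ, 0 < r → r < 1 → 1 ≤ μbar r)
    (hμanti : ∀ r₁ r₂ : ℝ, 0 < r₁ → r₁ ≤ r₂ → r₂ < 1 → μbar r₂ ≤ μbar r₁)
    (hf_mono : ∀ r₁ r₂ : ℝ, 0 < r₁ → r₁ ≤ r₂ → r₂ < 1 →
      Real.log (μbar r₁) / Real.log (1 / r₁) ≤ Real.log (μbar r₂) / Real.log (1 / r₂))
    (hpfun : ∀ x, 1 < pfun x)
    (hosc : ∀ (x₀ : En n) (r : ℝ), 0 < r → r < 1 → ball x₀ r ⊆ Ω →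
      ∀ x ∈ ball x₀ r, ∀ y ∈ ball x₀ r,
        pfun x - pfun y ≤ L * Real.log (μbar r) / Real.log (1 / r)) :
    ∀ (x₀ : En n) (r k : ℝ), 0 < r → r < 1 → ball x₀ r ⊆ Ω → r < k →
      r ≤ (r / k) ^ (s / ((n : ℝ) + s)) → (r / k) ^ (s / ((n : ℝ) + s)) < 1 →
      sSup ((fun x => (k / r) ^ pfun x) '' ball x₀ r) ≤
        μbar ((r / k) ^ (s / ((n : ℝ) + s))) ^ (L / (s / ((n : ℝ) + s))) *
          sInf ((fun x => (k / r) ^ pfun x) '' ball x₀ r) := by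
  intro x₀ r k hr hr1 hball hrk hle hlt
  set σ := s / ((n : ℝ) + s)
  set ρ := (r / k) ^ σ with hρ
  have hσ : 0 < σ := by positivity
  have hk : 0 < k := hr.trans hrk
  have ht : 0 < k / r := by positivity
  have hlogt : 0 < Real.log (k / r) := Real.log_pos ((one_lt_div hr).2 hrk)
  have hρ0 : 0 < ρ := hr.trans_le hle
  have hμ : 0 < μbar ρ := one_pos.trans_le (hμ1 ρ hρ0 hlt)
  have hlogρ : Real.log (1 / ρ) = σ * Real.log (k / r) := by
    rw [one_div, Real.log_inv, hρ, Real.log_rpow (by positivity), ← inv_div k r, Real.log_inv]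
    ring
  have key : ∀ x ∈ ball x₀ r, ∀ y ∈ ball x₀ r,
      (k / r) ^ pfun x ≤ μbar ρ ^ (L / σ) * (k / r) ^ pfun y := by
    intro x hx y hy
    have h₁ : pfun x - pfun y ≤ L * (Real.log (μbar ρ) / (σ * Real.log (k / r))) := by
      have h := hosc x₀ r hr hr1 hball x hx y hy
      rw [mul_div_assoc] at h
      rw [← hlogρ]
      exact h.trans (mul_le_mul_of_nonneg_left (hf_mono r ρ hr hle hlt) hL.le)
    have h₂ : Real.log (k / r) * (pfun x - pfun y) ≤ Real.log (μbar ρ) * (L / σ) :=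
      (mul_le_mul_of_nonneg_left h₁ hlogt.le).trans_eq (by field_simp)
    rw [Real.rpow_def_of_pos ht, Real.rpow_def_of_pos ht, Real.rpow_def_of_pos hμ, ← Real.exp_add,
      Real.exp_le_exp]
    linarith
  have hne : ((fun x => (k / r) ^ pfun x) '' ball x₀ r).Nonempty :=
    (nonempty_ball.2 hr).image _
  have hC : 0 < μbar ρ ^ (L / σ) := Real.rpow_pos_of_pos hμ _
  refine csSup_le hne (forall_mem_image.2 fun x hx => ?_)
  rw [← div_le_iff₀' hC]
  exact le_csInf hne (forall_mem_image.2 fun y hy => (div_le_iff₀' hC).2 (key x hx y hy))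

end
end

section
/- Tail-integral estimate: let B ⊂ ℝⁿ be a ball, let u ≥ 0 be measurable on B, and let m̄ > 0, θ₀ > 1 be such that |B ∩ {u ≥ N}| ≤ 2 (m̄/N)^{1/θ₀} |B| for every N ≥ m̄. Then for every θ with 0 < θ < 1/θ₀, one has ⨍_B u^θ dx ≤ (1 + 2θθ₀/(1 − θθ₀)) m̄^θ. -/
open MeasureTheory Metric Set Real

noncomputable section

/-- A nonnegative function on a probability space whose tails decay like `2 (m / N) ^ a` has a
`θ`-moment at most `(1 + 2 θ / (a - θ)) m ^ θ`, for every `0 < θ < a`. -/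
theorem lintegral_rpow_le_of_tail_le {α : Type*} [MeasurableSpace α] {μ : Measure α}
    [IsProbabilityMeasure μ] {f : α → ℝ} (f_nn : 0 ≤ᵐ[μ] f) (hf : AEMeasurable f μ)
    {m a θ : ℝ} (hm : 0 < m) (hθ : 0 < θ) (hθa : θ < a)
    (htail : ∀ N : ℝ, m ≤ N → μ {x | N ≤ f x} ≤ ENNReal.ofReal (2 * (m / N) ^ a)) :
    ∫⁻ x, ENNReal.ofReal (f x ^ θ) ∂μ ≤ ENNReal.ofReal ((1 + 2 * θ / (a - θ)) * m ^ θ) := by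
  have haθ : 0 < a - θ := sub_pos.2 hθa
  have hlow : ∫⁻ t in Ioc 0 m, μ {x | t ≤ f x} * ENNReal.ofReal (t ^ (θ - 1)) ≤
      ENNReal.ofReal (m ^ θ / θ) := by
    calc _ ≤ ∫⁻ t in Ioc 0 m, ENNReal.ofReal (t ^ (θ - 1)) :=
          lintegral_mono fun t ↦ mul_le_of_le_one_left' prob_le_one
      _ = ENNReal.ofReal (∫ t in Ioc 0 m, t ^ (θ - 1)) := by
          rw [ofReal_integral_eq_lintegral_ofReal]
          · exact (intervalIntegral.intervalIntegrable_rpow' (by linarith)).1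
          · filter_upwards [ae_restrict_mem measurableSet_Ioc] with t ht
            exact rpow_nonneg ht.1.le _
      _ = _ := by
          rw [← intervalIntegral.integral_of_le hm.le, integral_rpow (Or.inl (by linarith))]
          simp [zero_rpow hθ.ne']
  have hhigh : ∫⁻ t in Ioi m, μ {x | t ≤ f x} * ENNReal.ofReal (t ^ (θ - 1)) ≤
      ENNReal.ofReal (2 * m ^ θ / (a - θ)) := by
    calc _ ≤ ∫⁻ t in Ioi m, ENNReal.ofReal (2 * m ^ a * t ^ (θ - 1 - a)) := by
          refine setLIntegral_mono' measurableSet_Ioi fun t (ht : m < t) ↦ ?_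
          have ht0 : 0 < t := hm.trans ht
          refine (mul_le_mul_left (htail t ht.le) _).trans_eq ?_
          rw [← ENNReal.ofReal_mul (by positivity), div_rpow hm.le ht0.le, rpow_sub ht0 _ a]
          congr 1
          ring
      _ = ENNReal.ofReal (∫ t in Ioi m, 2 * m ^ a * t ^ (θ - 1 - a)) := by
          rw [ofReal_integral_eq_lintegral_ofReal]
          · exact (integrableOn_Ioi_rpow_of_lt (by linarith) hm).const_mul _
          · filter_upwards [ae_restrict_mem measurableSet_Ioi] with t (ht : m < t)
            have ht0 : 0 < t := hm.trans ht
            positivity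
      _ = _ := by
          rw [integral_const_mul, integral_Ioi_rpow_of_lt (by linarith) hm,
            show θ - 1 - a + 1 = -(a - θ) by ring, neg_div_neg_eq,
            show -(a - θ) = θ - a by ring, rpow_sub hm]
          congr 1
          field_simp
  rw [lintegral_rpow_eq_lintegral_meas_le_mul μ f_nn hf hθ, ← Ioc_union_Ioi_eq_Ioi hm.le,
    lintegral_union measurableSet_Ioi (Ioc_disjoint_Ioi le_rfl)]
  refine (mul_le_mul_right (add_le_add hlow hhigh) _).trans_eq ?_
  rw [← ENNReal.ofReal_add (by positivity) (by positivity), ← ENNReal.ofReal_mul hθ.le]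
  congr 1
  field_simp

/-- **Tail-integral estimate.**  Let `B = B_R(x₀) ⊂ ℝⁿ` be a ball, `u ≥ 0` measurable
on `B`, and `m̄ > 0`, `θ₀ > 1` such that
`|B ∩ {u ≥ N}| ≤ 2 (m̄/N)^{1/θ₀} |B|` for every `N ≥ m̄.`  Then for every
`0 < θ < 1/θ₀` one has `⨍_B u^θ ≤ (1 + 2θθ₀/(1 − θθ₀)) m̄^θ`. -/
theorem tail_integral_estimate
    (n : ℕ) (x₀ : En n) (R mbar θ₀ : ℝ) (u : En n → ℝ)
    (hn : 0 < n) (hR : 0 < R) (hm : 0 < mbar) (hθ₀ : 1 < θ₀)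
    (hu : Measurable u) (hu0 : ∀ x ∈ ball x₀ R, 0 ≤ u x)
    (htail : ∀ N : ℝ, mbar ≤ N →
      volume (ball x₀ R ∩ {x | N ≤ u x}) ≤
        ENNReal.ofReal (2 * (mbar / N) ^ (1 / θ₀)) * volume (ball x₀ R)) :
    ∀ θ : ℝ, 0 < θ → θ < 1 / θ₀ →
      (⨍ x in ball x₀ R, u x ^ θ) ≤ (1 + 2 * θ * θ₀ / (1 - θ * θ₀)) * mbar ^ θ := by
  intro θ hθ hθ'
  have hθ₀' : 0 < θ₀ := by linarith
  have hden : 0 < 1 - θ * θ₀ := sub_pos.2 ((lt_div_iff₀ hθ₀').1 hθ')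
  have hB0 : volume (ball x₀ R) ≠ 0 := (measure_ball_pos volume x₀ hR).ne'
  have hBtop : volume (ball x₀ R) ≠ ⊤ := measure_ball_lt_top.ne
  let μ : Measure (En n) := (volume (ball x₀ R))⁻¹ • volume.restrict (ball x₀ R)
  have : IsProbabilityMeasure μ := ⟨by simp [μ, ENNReal.inv_mul_cancel hB0 hBtop]⟩
  have hnn : 0 ≤ᵐ[μ] u :=
    Measure.ae_smul_measure ((ae_restrict_mem measurableSet_ball).mono hu0) _
  have htail' (N : ℝ) (hN : mbar ≤ N) :
      μ {x | N ≤ u x} ≤ ENNReal.ofReal (2 * (mbar / N) ^ (1 / θ₀)) := by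
    have hmeas : MeasurableSet {x | N ≤ u x} := measurableSet_le measurable_const hu
    rw [Measure.smul_apply, Measure.restrict_apply hmeas, inter_comm, smul_eq_mul, mul_comm,
      ← div_eq_mul_inv]
    exact ENNReal.div_le_of_le_mul (htail N hN)
  have hmom := lintegral_rpow_le_of_tail_le hnn hu.aemeasurable hm hθ hθ' htail'
  have hconst : 2 * θ / (1 / θ₀ - θ) = 2 * θ * θ₀ / (1 - θ * θ₀) := by
    rw [show 1 / θ₀ - θ = (1 - θ * θ₀) / θ₀ by field_simp, div_div_eq_mul_div]
  rw [hconst] at hmom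
  have havg : (⨍ x in ball x₀ R, u x ^ θ) = ∫ x, u x ^ θ ∂μ := by
    simp [average, μ]
  rw [havg, integral_eq_lintegral_of_nonneg_ae (hnn.mono fun x hx ↦ rpow_nonneg hx θ)
    (hu.pow_const θ).aestronglyMeasurable]
  exact ENNReal.toReal_le_of_le_ofReal (by positivity) hmom

end
end
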